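/- Let f₁, f₂ : ℝⁿ → ℝ be continuous on the compact box domain Ω, and let 0 ≤ L_min < L_max. If Dist_IVC(f₁, f₂) = 0, then f₁ − f₂ is constant on Ω, i.e. there exists C ∈ ℝ with f₁(y) = f₂(y) + C for all y ∈ Ω. -/

import Mathlib

/-- The value change (VC) of `f : ℝⁿ → ℝ` at `x` over the domain `Ω`,
with window `∏ᵢ [xᵢ - L/2, xᵢ + L/2]`. -/
noncomputable def VC {n : ℕ} (Ω : Set (Fin n → ℝ)) (f : (Fin n → ℝ) → ℝ)
    (L : ℝ) (x : Fin n → ℝ) : ℝ :=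
  sSup {v : ℝ | ∃ y₁ ∈ Ω ∩ Set.Icc (fun i => x i - L / 2) (fun i => x i + L / 2),
    ∃ y₂ ∈ Ω ∩ Set.Icc (fun i => x i - L / 2) (fun i => x i + L / 2), v = |f y₁ - f y₂|}

/-- The integral value change (IVC) of `f` at `x`:
the average of `VC_L(f, x)` over `L ∈ [Lmin, Lmax]`. -/
noncomputable def IVC {n : ℕ} (Ω : Set (Fin n → ℝ)) (f : (Fin n → ℝ) → ℝ)
    (Lmin Lmax : ℝ) (x : Fin n → ℝ) : ℝ :=
  (1 / (Lmax - Lmin)) * ∫ L in Lmin..Lmax, VC Ω f L x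

/-- The IVC distance between `f₁` and `f₂`: `∫_Ω IVC(f₁ − f₂, x) dx`. -/
noncomputable def DistIVC {n : ℕ} (Ω : Set (Fin n → ℝ)) (f₁ f₂ : (Fin n → ℝ) → ℝ)
    (Lmin Lmax : ℝ) : ℝ :=
  ∫ x in Ω, IVC Ω (fun y => f₁ y - f₂ y) Lmin Lmax x

theorem VC_bdd {n : ℕ} {a b : Fin n → ℝ} {g : (Fin n → ℝ) → ℝ}
    (hg : ContinuousOn g (Set.Icc a b)) (L : ℝ) (x : Fin n → ℝ) :
    BddAbove {v : ℝ | ∃ y₁ ∈ Set.Icc a b ∩ Set.Icc (fun i => x i - L / 2) (fun i => x i + L / 2),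
    ∃ y₂ ∈ Set.Icc a b ∩ Set.Icc (fun i => x i - L / 2) (fun i => x i + L / 2),
      v = |g y₁ - g y₂|} := by
  obtain ⟨M, hM⟩ := isCompact_Icc.exists_bound_of_continuousOn hg
  refine ⟨M + M, ?_⟩
  rintro v ⟨y₁, h₁, y₂, h₂, rfl⟩
  have e1 := hM y₁ h₁.1
  have e2 := hM y₂ h₂.1
  rw [Real.norm_eq_abs] at e1 e2
  exact (abs_sub _ _).trans (add_le_add e1 e2)

theorem VC_nonneg {n : ℕ} (Ω : Set (Fin n → ℝ)) (g : (Fin n → ℝ) → ℝ) (L : ℝ)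
    (x : Fin n → ℝ) : 0 ≤ VC Ω g L x := by
  apply Real.sSup_nonneg
  rintro v ⟨y₁, h₁, y₂, h₂, rfl⟩
  exact abs_nonneg _

theorem le_VC {n : ℕ} {a b : Fin n → ℝ} {g : (Fin n → ℝ) → ℝ}
    (hg : ContinuousOn g (Set.Icc a b)) (L : ℝ) (x y₁ y₂ : Fin n → ℝ)
    (h₁ : y₁ ∈ Set.Icc a b ∩ Set.Icc (fun i => x i - L / 2) (fun i => x i + L / 2))
    (h₂ : y₂ ∈ Set.Icc a b ∩ Set.Icc (fun i => x i - L / 2) (fun i => x i + L / 2)) :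
    |g y₁ - g y₂| ≤ VC (Set.Icc a b) g L x :=
  le_csSup (VC_bdd hg L x) ⟨y₁, h₁, y₂, h₂, rfl⟩

theorem VC_le {n : ℕ} {a b : Fin n → ℝ} {g : (Fin n → ℝ) → ℝ}
    (L : ℝ) (hL : 0 ≤ L) (x : Fin n → ℝ) (hx : x ∈ Set.Icc a b) (c : ℝ)
    (h : ∀ y₁ ∈ Set.Icc a b ∩ Set.Icc (fun i => x i - L / 2) (fun i => x i + L / 2),
      ∀ y₂ ∈ Set.Icc a b ∩ Set.Icc (fun i => x i - L / 2) (fun i => x i + L / 2),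
      |g y₁ - g y₂| ≤ c) :
    VC (Set.Icc a b) g L x ≤ c := by
  have hxx : x ∈ Set.Icc a b ∩ Set.Icc (fun i => x i - L / 2) (fun i => x i + L / 2) :=
    ⟨hx, fun i => by dsimp only; linarith, fun i => by dsimp only; linarith⟩
  unfold VC
  refine csSup_le ⟨|g x - g x|, x, hxx, x, hxx, rfl⟩ ?_
  rintro v ⟨y₁, h₁, y₂, h₂, rfl⟩
  exact h y₁ h₁ y₂ h₂

theorem VC_monoOn {n : ℕ} {a b : Fin n → ℝ} {g : (Fin n → ℝ) → ℝ}
    (hg : ContinuousOn g (Set.Icc a b)) (x : Fin n → ℝ) (hx : x ∈ Set.Icc a b) :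
    MonotoneOn (fun L => VC (Set.Icc a b) g L x) (Set.Ici 0) := by
  intro L hL L' hL' hLL
  have key : Set.Icc (fun i => x i - L / 2) (fun i => x i + L / 2) ⊆
      Set.Icc (fun i => x i - L' / 2) (fun i => x i + L' / 2) := by
    apply Set.Icc_subset_Icc
    · intro i; dsimp only; linarith
    · intro i; dsimp only; linarith
  exact VC_le L hL x hx _ fun y₁ h₁ y₂ h₂ =>
    le_VC hg L' x y₁ y₂ ⟨h₁.1, key h₁.2⟩ ⟨h₂.1, key h₂.2⟩

theorem VC_move {n : ℕ} {a b : Fin n → ℝ} (L : ℝ) (hL : 0 ≤ L) (x x' : Fin n → ℝ)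
    (hx' : x' ∈ Set.Icc a b) (y : Fin n → ℝ)
    (hy : y ∈ Set.Icc a b ∩ Set.Icc (fun i => x i - L / 2) (fun i => x i + L / 2)) :
    ∃ y' ∈ Set.Icc a b ∩ Set.Icc (fun i => x' i - L / 2) (fun i => x' i + L / 2),
      dist y y' ≤ dist x x' := by
  have B : ∀ i, ∃ t, a i ≤ t ∧ t ≤ b i ∧ x' i - L / 2 ≤ t ∧ t ≤ x' i + L / 2 ∧
      |y i - t| ≤ |x i - x' i| := by
    intro i
    have h1 := hy.1.1 i
    have h2 := hy.1.2 i
    have h3 := hy.2.1 i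
    have h4 := hy.2.2 i
    have h5 := hx'.1 i
    have h6 := hx'.2 i
    dsimp only at h3 h4
    have p1 := le_abs_self (x i - x' i)
    have p2 := neg_abs_le (x i - x' i)
    rcases lt_or_ge (y i) (x' i - L / 2) with h | h
    · refine ⟨x' i - L / 2, by linarith, by linarith, le_rfl, by linarith, ?_⟩
      rw [abs_le]; constructor <;> linarith
    rcases lt_or_ge (x' i + L / 2) (y i) with h' | h'
    · refine ⟨x' i + L / 2, by linarith, by linarith, by linarith, le_rfl, ?_⟩
      rw [abs_le]; constructor <;> linarith
    · exact ⟨y i, h1, h2, h, h', by simp⟩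
  choose t t1 t2 t3 t4 t5 using B
  refine ⟨t, ⟨⟨t1, t2⟩, ⟨t3, t4⟩⟩, ?_⟩
  rw [dist_pi_le_iff dist_nonneg]
  intro i
  rw [Real.dist_eq]
  exact (t5 i).trans (by rw [← Real.dist_eq]; exact dist_le_pi_dist x x' i)

theorem VC_close {n : ℕ} {a b : Fin n → ℝ} {g : (Fin n → ℝ) → ℝ}
    (hg : ContinuousOn g (Set.Icc a b)) (ε δ : ℝ)
    (h : ∀ y ∈ Set.Icc a b, ∀ y' ∈ Set.Icc a b, dist y y' < δ → dist (g y) (g y') < ε)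
    (L : ℝ) (hL : 0 ≤ L) (x x' : Fin n → ℝ) (hx : x ∈ Set.Icc a b)
    (hx' : x' ∈ Set.Icc a b) (hd : dist x x' < δ) :
    VC (Set.Icc a b) g L x ≤ VC (Set.Icc a b) g L x' + 2 * ε := by
  apply VC_le L hL x hx
  intro y₁ h₁ y₂ h₂
  obtain ⟨z₁, hz₁, d₁⟩ := VC_move L hL x x' hx' y₁ h₁
  obtain ⟨z₂, hz₂, d₂⟩ := VC_move L hL x x' hx' y₂ h₂
  have e1 := h y₁ h₁.1 z₁ hz₁.1 (d₁.trans_lt hd)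
  have e2 := h y₂ h₂.1 z₂ hz₂.1 (d₂.trans_lt hd)
  have e3 := le_VC hg L x' z₁ z₂ hz₁ hz₂
  rw [Real.dist_eq, abs_lt] at e1 e2
  rw [abs_le] at e3 ⊢
  constructor <;> linarith [e1.1, e1.2, e2.1, e2.2, e3.1, e3.2]

theorem VC_intervalIntegrable {n : ℕ} {a b : Fin n → ℝ} {g : (Fin n → ℝ) → ℝ}
    (hg : ContinuousOn g (Set.Icc a b)) (x : Fin n → ℝ) (hx : x ∈ Set.Icc a b)
    (s t : ℝ) (hs : 0 ≤ s) (ht : 0 ≤ t) :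
    IntervalIntegrable (fun L => VC (Set.Icc a b) g L x) MeasureTheory.volume s t := by
  apply MonotoneOn.intervalIntegrable
  apply (VC_monoOn hg x hx).mono
  intro u hu
  exact (le_min hs ht).trans hu.1

theorem IVC_continuousOn {n : ℕ} {a b : Fin n → ℝ} {g : (Fin n → ℝ) → ℝ}
    (hg : ContinuousOn g (Set.Icc a b)) (s t : ℝ) (hs : 0 ≤ s) (hst : s < t) :
    ContinuousOn (fun x => ∫ L in s..t, VC (Set.Icc a b) g L x) (Set.Icc a b) := by
  have hu := isCompact_Icc.uniformContinuousOn_of_continuous hg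
  rw [Metric.uniformContinuousOn_iff] at hu
  rw [Metric.continuousOn_iff]
  intro x hx ε hε
  have hp : 0 < t - s := sub_pos.2 hst
  obtain ⟨δ, hδ, h⟩ := hu (ε / (4 * (t - s))) (by positivity)
  refine ⟨δ, hδ, fun x' hx' hd => ?_⟩
  have main : ∀ u ∈ Set.Icc a b, ∀ v ∈ Set.Icc a b, dist u v < δ →
      (∫ L in s..t, VC (Set.Icc a b) g L u) ≤ (∫ L in s..t, VC (Set.Icc a b) g L v) + ε / 2 := by
    intro u hu v hv huv
    have iu := VC_intervalIntegrable hg u hu s t hs (hs.trans hst.le)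
    have iv := VC_intervalIntegrable hg v hv s t hs (hs.trans hst.le)
    have := intervalIntegral.integral_mono_on (μ := MeasureTheory.volume) hst.le iu
      (iv.add (intervalIntegrable_const (c := 2 * (ε / (4 * (t - s))))))
      (fun L hL => VC_close hg _ δ h L (hs.trans hL.1) u v hu hv huv)
    rw [intervalIntegral.integral_add iv intervalIntegrable_const,
      intervalIntegral.integral_const, smul_eq_mul] at this
    have e : (t - s) * (2 * (ε / (4 * (t - s)))) = ε / 2 := by field_simp; norm_num
    rwa [e] at this
  have m1 := main x' hx' x hx hd
  have m2 := main x hx x' hx' (by rwa [dist_comm])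
  rw [Real.dist_eq, abs_lt]
  constructor <;> linarith

theorem VC_eq_zero {n : ℕ} {a b : Fin n → ℝ} {g : (Fin n → ℝ) → ℝ}
    (hg : ContinuousOn g (Set.Icc a b)) (s t : ℝ) (hs : 0 ≤ s) (hst : s < t)
    (x : Fin n → ℝ) (hx : x ∈ Set.Icc a b) (h : ∫ L in s..t, VC (Set.Icc a b) g L x = 0) :
    VC (Set.Icc a b) g ((s + t) / 2) x = 0 := by
  have hm1 : s < (s + t) / 2 := by linarith
  have hm2 : (s + t) / 2 < t := by linarith
  have i1 := VC_intervalIntegrable hg x hx s ((s + t) / 2) hs (by linarith)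
  have i2 := VC_intervalIntegrable hg x hx ((s + t) / 2) t (by linarith) (by linarith)
  have e := intervalIntegral.integral_add_adjacent_intervals i1 i2
  have n1 : 0 ≤ ∫ L in s..((s + t) / 2), VC (Set.Icc a b) g L x :=
    intervalIntegral.integral_nonneg hm1.le fun L _ => VC_nonneg _ _ _ _
  have := intervalIntegral.integral_mono_on (μ := MeasureTheory.volume) hm2.le
    (intervalIntegrable_const (c := VC (Set.Icc a b) g ((s + t) / 2) x)) i2
    (fun L hL => VC_monoOn hg x hx (show 0 ≤ (s + t) / 2 by linarith)
      (show 0 ≤ L by linarith [hL.1]) hL.1)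
  rw [intervalIntegral.integral_const, smul_eq_mul] at this
  have n2 := VC_nonneg (Set.Icc a b) g ((s + t) / 2) x
  by_contra hne
  have n3 := lt_of_le_of_ne n2 (Ne.symm hne)
  have := mul_pos (sub_pos.2 hm2) n3
  linarith

/-- If `f₁, f₂` are continuous on the compact box `Ω` and `Dist_IVC(f₁, f₂) = 0`,
then `f₁ − f₂` is constant on `Ω`. -/
theorem stmt_10 {n : ℕ} (a b : Fin n → ℝ) (hab : ∀ i, a i < b i)
    (f₁ f₂ : (Fin n → ℝ) → ℝ)
    (hf₁ : ContinuousOn f₁ (Set.Icc a b)) (hf₂ : ContinuousOn f₂ (Set.Icc a b))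
    (Lmin Lmax : ℝ) (hLmin : 0 ≤ Lmin) (hL : Lmin < Lmax)
    (hdist : DistIVC (Set.Icc a b) f₁ f₂ Lmin Lmax = 0) :
    ∃ C : ℝ, ∀ y ∈ Set.Icc a b, f₁ y = f₂ y + C := by
  have hg : ContinuousOn (fun y => f₁ y - f₂ y) (Set.Icc a b) := hf₁.sub hf₂
  unfold DistIVC at hdist
  set g : (Fin n → ℝ) → ℝ := fun y => f₁ y - f₂ y with hgdef
  have hp : 0 < Lmax - Lmin := sub_pos.2 hL
  have hc := IVC_continuousOn hg Lmin Lmax hLmin hL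
  have hz : ∫ x in Set.Icc a b, (∫ L in Lmin..Lmax, VC (Set.Icc a b) g L x) = 0 := by
    simp only [IVC] at hdist
    rw [MeasureTheory.integral_const_mul] at hdist
    rcases mul_eq_zero.1 hdist with h | h
    · exact absurd h (by positivity)
    · exact h
  rw [MeasureTheory.setIntegral_eq_zero_iff_of_nonneg_ae
    (Filter.Eventually.of_forall fun x =>
      intervalIntegral.integral_nonneg hL.le fun L _ => VC_nonneg _ _ _ _)
    (hc.integrableOn_compact isCompact_Icc)] at hz
  have hae : ∀ᵐ x, x ∈ Set.Icc a b → ∫ L in Lmin..Lmax, VC (Set.Icc a b) g L x = 0 :=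
    (MeasureTheory.ae_restrict_iff' measurableSet_Icc).1 hz
  have hdense := MeasureTheory.Measure.dense_of_ae hae
  set r : ℝ := (Lmin + Lmax) / 2 / 2 with hr
  have hr0 : 0 < r := by rw [hr]; linarith
  have hloc : ∀ y ∈ Set.Icc a b, ∀ z ∈ Set.Icc a b, dist z y < r / 2 → g z = g y := by
    intro y hy z hz hzy
    have hy' : y ∈ closure (interior (Set.Icc a b)) := by
      rw [← Set.pi_univ_Icc, interior_pi_set Set.finite_univ, closure_pi_set]
      intro i _
      show y i ∈ closure (interior (Set.Icc (a i) (b i)))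
      rw [interior_Icc, closure_Ioo (hab i).ne]
      exact ⟨hy.1 i, hy.2 i⟩
    obtain ⟨w, hw1, hw2⟩ := mem_closure_iff.1 hy' (Metric.ball y (r / 2)) Metric.isOpen_ball
      (Metric.mem_ball_self (by positivity))
    obtain ⟨x, hx1, hx2⟩ := hdense.inter_open_nonempty
      (Metric.ball y (r / 2) ∩ interior (Set.Icc a b))
      (Metric.isOpen_ball.inter isOpen_interior) ⟨w, hw1, hw2⟩
    have hxΩ : x ∈ Set.Icc a b := interior_subset hx1.2
    have hv := VC_eq_zero hg Lmin Lmax hLmin hL x hxΩ (hx2 hxΩ)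
    have hin : ∀ u ∈ Set.Icc a b, dist u x ≤ r →
        u ∈ Set.Icc a b ∩ Set.Icc (fun i => x i - (Lmin + Lmax) / 2 / 2)
          (fun i => x i + (Lmin + Lmax) / 2 / 2) := by
      intro u hu hd
      have q : ∀ i, |u i - x i| ≤ r := fun i => by
        rw [← Real.dist_eq]; exact (dist_le_pi_dist u x i).trans hd
      refine ⟨hu, fun i => ?_, fun i => ?_⟩
      · have := (abs_le.1 (q i)).1
        dsimp only; linarith
      · have := (abs_le.1 (q i)).2
        dsimp only; linarith
    have hxy : dist x y < r / 2 := hx1.1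
    have k := le_VC hg _ x z y
      (hin z hz (by have := dist_triangle_right z x y; linarith))
      (hin y hy (by rw [dist_comm]; linarith))
    rw [hv] at k
    exact sub_eq_zero.1 (abs_eq_zero.1 (le_antisymm k (abs_nonneg _)))
  have haΩ : a ∈ Set.Icc a b := ⟨le_rfl, fun i => (hab i).le⟩
  have hpre : IsPreconnected (Set.Icc a b) := (convex_Icc a b).isPreconnected
  have : PreconnectedSpace (Set.Icc a b) := isPreconnected_iff_preconnectedSpace.1 hpre
  have hlc : IsLocallyConstant (fun y : Set.Icc a b => g y) := by
    rw [IsLocallyConstant.iff_eventually_eq]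
    intro y
    filter_upwards [Metric.ball_mem_nhds y (half_pos hr0)] with z hz
    exact hloc y y.2 z z.2 hz
  refine ⟨g a, fun y hy => ?_⟩
  have := hlc.apply_eq_of_preconnectedSpace ⟨y, hy⟩ ⟨a, haΩ⟩
  have h2 : f₁ y - f₂ y = g a := this
  linarith
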